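/- Let V be the vector space over ℂ spanned inside ⋀³(ℂ^7) (generators e₀,...,e₆) by the 24 vectors e_t ∧ ∂e_S where S ranges over the six 3-subsets {0,1,2},{0,3,4},{0,5,6},{2,3,5},{1,4,5},{1,3,6} and t ranges over {0,...,6} \ S, with ∂e_{ijk} = e_{jk} - e_{ik} + e_{ij}. Then dim V = 19. -/

import Mathlib

open ExteriorAlgebra

/-- The generator `e_a` of the exterior algebra `⋀(ℂ^7)`. -/
noncomputable def e (a : Fin 7) : ExteriorAlgebra ℂ (Fin 7 → ℂ) :=
  ι ℂ (Pi.single a (1 : ℂ))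

/-- `∂e_{ijk} = e_{jk} - e_{ik} + e_{ij}`. -/
noncomputable def bdry (i j k : Fin 7) : ExteriorAlgebra ℂ (Fin 7 → ℂ) :=
  e j * e k - e i * e k + e i * e j

/-- The six `3`-circuits of the matroid of `A(S₃)`. -/
def circuits : List (Fin 7 × Fin 7 × Fin 7) :=
  [(0, 1, 2), (0, 3, 4), (0, 5, 6), (2, 3, 5), (1, 4, 5), (1, 3, 6)]

set_option linter.unusedSimpArgs false

/-- Index data `(t, i, j, k)` of nineteen vectors `e_t ∂e_{ijk}` forming a basis. -/
def idx : Fin 19 → Fin 7 × Fin 7 × Fin 7 × Fin 7 :=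
  ![(3, 0, 1, 2),
    (4, 0, 1, 2),
    (5, 0, 1, 2),
    (6, 0, 1, 2),
    (1, 0, 3, 4),
    (2, 0, 3, 4),
    (5, 0, 3, 4),
    (6, 0, 3, 4),
    (1, 0, 5, 6),
    (2, 0, 5, 6),
    (3, 0, 5, 6),
    (4, 0, 5, 6),
    (0, 2, 3, 5),
    (1, 2, 3, 5),
    (4, 2, 3, 5),
    (6, 2, 3, 5),
    (0, 1, 4, 5),
    (6, 1, 4, 5),
    (0, 1, 3, 6)]

/-- The basis vectors. -/
noncomputable def vec (n : Fin 19) : ExteriorAlgebra ℂ (Fin 7 → ℂ) :=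
  e (idx n).1 * bdry (idx n).2.1 (idx n).2.2.1 (idx n).2.2.2

/-- The nineteen coordinates that separate the basis vectors. -/
def tri : Fin 19 → Fin 3 → Fin 7 :=
  ![![0, 1, 3], ![0, 1, 4], ![0, 1, 5], ![0, 1, 6], ![0, 2, 3], ![0, 2, 4], ![0, 2, 5], ![0, 3, 5], ![0, 3, 6], ![0, 4, 5], ![1, 2, 3], ![1, 2, 4], ![1, 2, 5], ![1, 3, 4], ![1, 3, 5], ![1, 4, 6], ![2, 3, 4], ![2, 3, 6], ![3, 4, 5]]

/-- Coordinate functional on the exterior algebra attached to a triple of indices. -/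
noncomputable def coord (T : Fin 3 → Fin 7) : ExteriorAlgebra ℂ (Fin 7 → ℂ) →ₗ[ℂ] ℂ :=
  liftAlternating (R := ℂ) (M := Fin 7 → ℂ) (N := ℂ)
    (Function.update (fun _ => 0) 3
      ((Matrix.detRowAlternating (R := ℂ) (n := Fin 3)).compLinearMap (LinearMap.funLeft ℂ ℂ T)))

/-- Integer Kronecker delta. -/
def dl (a b : Fin 7) : ℤ := if a = b then 1 else 0

/-- The value of `coord T` on `e a * e b * e c`, as an integer. -/
def minor (T : Fin 3 → Fin 7) (a b c : Fin 7) : ℤ :=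
  dl (T 0) a * dl (T 1) b * dl (T 2) c - dl (T 0) a * dl (T 2) b * dl (T 1) c
  - dl (T 1) a * dl (T 0) b * dl (T 2) c + dl (T 1) a * dl (T 2) b * dl (T 0) c
  + dl (T 2) a * dl (T 0) b * dl (T 1) c - dl (T 2) a * dl (T 1) b * dl (T 0) c

lemma coord_e (T : Fin 3 → Fin 7) (a b c : Fin 7) :
    coord T (e a * (e b * e c)) = (minor T a b c : ℂ) := by
  have h : e a * (e b * e c) =
      ιMulti ℂ 3 ![Pi.single a (1 : ℂ), Pi.single b (1 : ℂ), Pi.single c (1 : ℂ)] := by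
    simp [ιMulti_apply, e]
  rw [h, coord, liftAlternating_apply_ιMulti]
  rw [Function.update_self, AlternatingMap.compLinearMap_apply]
  refine (Matrix.det_fin_three _).trans ?_
  simp [LinearMap.funLeft_apply, Pi.single_apply, minor, dl]

/-- The matrix of the nineteen coordinates of the nineteen vectors. -/
def coeffs : Matrix (Fin 19) (Fin 19) ℤ := fun n m =>
  minor (tri m) (idx n).1 (idx n).2.2.1 (idx n).2.2.2
  - minor (tri m) (idx n).1 (idx n).2.1 (idx n).2.2.2
  + minor (tri m) (idx n).1 (idx n).2.1 (idx n).2.2.1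

/-- The inverse of `coeffs`. -/
def coeffsInv : Matrix (Fin 19) (Fin 19) ℤ :=
  ![![0, 0, 0, 1, 0, 0, 0, -1, 0, 0, 0, 0, 0, 0, 0, 0, 0, 0, 1],
    ![0, 0, 0, 1, 0, 0, 0, 0, -1, 0, 0, 1, 0, 0, 0, 0, 1, 0, 0],
    ![0, 0, 0, 1, 0, 0, 0, 0, -1, 0, 0, 0, 0, 0, 0, 0, 0, 0, 0],
    ![0, 0, 0, 1, 0, 0, 0, 0, 0, 0, 0, 0, 0, 0, 0, 0, 0, 0, 0],
    ![0, 0, 0, 0, 0, 0, 0, -1, 0, -1, 1, 0, 1, 0, 0, 0, 0, 0, 0],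
    ![0, 0, 0, 0, 0, 1, -1, 0, 0, -1, 0, 1, 1, 0, -1, 0, 0, 0, 0],
    ![0, 0, 0, 0, 0, 0, 0, 0, 0, -1, 0, 0, 0, 0, 0, 0, 0, 0, 0],
    ![0, 0, 0, 0, 0, 0, 0, 1, 0, 0, -1, 0, 0, 0, 0, 0, 0, 0, 0],
    ![0, 0, 0, 0, 0, 0, 0, 1, 0, 0, 0, 0, 0, 0, 0, 0, 0, 0, 0],
    ![0, 0, 0, 0, 0, 0, 0, 0, 0, 0, 0, -1, 0, 0, 0, 0, 0, 0, 0],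
    ![1, 0, 0, -1, 0, 0, 0, 0, 0, -1, 1, 0, 1, 0, 0, 0, 0, 0, -1],
    ![0, 1, 0, -1, 0, 1, -1, 0, 1, -1, 0, 0, 1, 0, -1, 0, -1, 0, 0],
    ![0, 0, 1, -1, 0, 0, 0, 0, 1, -1, 0, 0, 0, 0, 0, 0, 0, 0, 0],
    ![0, 0, 0, 0, 1, 0, 0, -1, 1, 0, 0, -1, 0, 0, 0, 0, -1, 0, 1],
    ![-1, 0, 1, 0, 0, 0, 0, 0, 1, 0, -1, 0, -1, 1, 0, 0, 0, 0, 1],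
    ![0, 0, 0, 0, 0, 0, 0, 0, 0, 0, 0, 0, 0, 0, 0, 0, 0, 1, 0],
    ![0, 0, 0, 0, 0, 0, 1, -1, 0, 0, 1, -1, 0, 0, 1, 0, 0, 0, 0],
    ![0, 0, 0, 0, 0, 0, 0, 0, 0, 0, 0, 0, 0, 0, 0, 1, 0, 0, 0],
    ![0, 0, 0, 0, 0, 0, 1, -1, 0, 0, 1, -1, 0, 0, 0, 0, 0, 0, 0]]

lemma coeffs_mul : coeffs * coeffsInv = 1 := by
  decide +kernel

lemma linearIndependent_vec : LinearIndependent ℂ vec := by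
  apply LinearIndependent.of_comp (LinearMap.pi fun m => coord (tri m))
  have h : (LinearMap.pi fun m => coord (tri m)) ∘ vec = (coeffs.map (Int.castRingHom ℂ)).row := by
    funext n m
    simp [vec, bdry, mul_add, mul_sub, coord_e, coeffs, Matrix.row]
  rw [h, Matrix.linearIndependent_rows_iff_isUnit, Matrix.isUnit_iff_isUnit_det]
  have h2 := congrArg (fun M => (M.map (Int.castRingHom ℂ)).det) coeffs_mul
  simp only [Matrix.map_mul, Matrix.det_mul] at h2
  refine IsUnit.of_mul_eq_one _ (h2.trans ?_)
  rw [Matrix.map_one _ (map_zero _) (map_one _), Matrix.det_one]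

lemma e_swap (a b : Fin 7) : e a * e b = - (e b * e a) := by
  rw [eq_neg_iff_add_eq_zero]
  exact ι_add_mul_swap _ _

lemma e_swap_left (a b : Fin 7) (x : ExteriorAlgebra ℂ (Fin 7 → ℂ)) :
    e a * (e b * x) = - (e b * (e a * x)) := by
  rw [← mul_assoc, e_swap, neg_mul, mul_assoc]

lemma e_sq (a : Fin 7) : e a * e a = 0 := ι_sq_zero _

lemma rel_2145 : e 2 * bdry 1 4 5 =
    -vec 1 + vec 2 - vec 5 + vec 6 - vec 12 + vec 14 + vec 16 := by
  simp only [vec, idx, bdry, mul_add, mul_sub, Matrix.cons_val]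
  simp only [mul_neg, neg_neg, mul_zero, e_swap 1 0, e_swap 2 0, e_swap 2 1, e_swap 3 0, e_swap 3 1, e_swap 3 2, e_swap 4 0, e_swap 4 1, e_swap 4 2, e_swap 4 3, e_swap 5 0, e_swap 5 1, e_swap 5 2, e_swap 5 3, e_swap 5 4,
    e_swap_left 1 0, e_swap_left 2 0, e_swap_left 2 1, e_swap_left 3 0, e_swap_left 3 1, e_swap_left 3 2, e_swap_left 4 0, e_swap_left 4 1, e_swap_left 4 2, e_swap_left 4 3, e_swap_left 5 0, e_swap_left 5 1, e_swap_left 5 2, e_swap_left 5 3, e_swap_left 5 4]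
  abel

lemma rel_3145 : e 3 * bdry 1 4 5 =
    -vec 0 + vec 2 - vec 4 + vec 6 - vec 12 + vec 13 + vec 16 := by
  simp only [vec, idx, bdry, mul_add, mul_sub, Matrix.cons_val]
  simp only [mul_neg, neg_neg, mul_zero, e_swap 1 0, e_swap 2 0, e_swap 2 1, e_swap 3 0, e_swap 3 1, e_swap 3 2, e_swap 4 0, e_swap 4 1, e_swap 4 2, e_swap 4 3, e_swap 5 0, e_swap 5 1, e_swap 5 2, e_swap 5 3, e_swap 5 4,
    e_swap_left 1 0, e_swap_left 2 0, e_swap_left 2 1, e_swap_left 3 0, e_swap_left 3 1, e_swap_left 3 2, e_swap_left 4 0, e_swap_left 4 1, e_swap_left 4 2, e_swap_left 4 3, e_swap_left 5 0, e_swap_left 5 1, e_swap_left 5 2, e_swap_left 5 3, e_swap_left 5 4]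
  abel

lemma rel_2136 : e 2 * bdry 1 3 6 =
    -vec 0 + vec 3 + vec 9 - vec 10 - vec 12 + vec 15 + vec 18 := by
  simp only [vec, idx, bdry, mul_add, mul_sub, Matrix.cons_val]
  simp only [mul_neg, neg_neg, mul_zero, e_swap 1 0, e_swap 2 0, e_swap 2 1, e_swap 3 0, e_swap 3 1, e_swap 3 2, e_swap 5 0, e_swap 5 1, e_swap 5 2, e_swap 5 3, e_swap 6 0, e_swap 6 1, e_swap 6 2, e_swap 6 3, e_swap 6 5,
    e_swap_left 1 0, e_swap_left 2 0, e_swap_left 2 1, e_swap_left 3 0, e_swap_left 3 1, e_swap_left 3 2, e_swap_left 5 0, e_swap_left 5 1, e_swap_left 5 2, e_swap_left 5 3, e_swap_left 6 0, e_swap_left 6 1, e_swap_left 6 2, e_swap_left 6 3, e_swap_left 6 5]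
  abel

lemma rel_4136 : e 4 * bdry 1 3 6 =
    vec 4 - vec 7 + vec 8 - vec 11 - vec 16 + vec 17 + vec 18 := by
  simp only [vec, idx, bdry, mul_add, mul_sub, Matrix.cons_val]
  simp only [mul_neg, neg_neg, mul_zero, e_swap 1 0, e_swap 3 0, e_swap 3 1, e_swap 4 0, e_swap 4 1, e_swap 4 3, e_swap 5 0, e_swap 5 1, e_swap 5 3, e_swap 5 4, e_swap 6 0, e_swap 6 1, e_swap 6 3, e_swap 6 4, e_swap 6 5,
    e_swap_left 1 0, e_swap_left 3 0, e_swap_left 3 1, e_swap_left 4 0, e_swap_left 4 1, e_swap_left 4 3, e_swap_left 5 0, e_swap_left 5 1, e_swap_left 5 3, e_swap_left 5 4, e_swap_left 6 0, e_swap_left 6 1, e_swap_left 6 3, e_swap_left 6 4, e_swap_left 6 5]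
  abel

lemma rel_5136 : e 5 * bdry 1 3 6 =
    -vec 0 + vec 2 + vec 8 - vec 10 - vec 12 + vec 13 + vec 18 := by
  simp only [vec, idx, bdry, mul_add, mul_sub, Matrix.cons_val]
  simp only [mul_neg, neg_neg, mul_zero, e_swap 1 0, e_swap 2 0, e_swap 2 1, e_swap 3 0, e_swap 3 1, e_swap 3 2, e_swap 5 0, e_swap 5 1, e_swap 5 2, e_swap 5 3, e_swap 6 0, e_swap 6 1, e_swap 6 2, e_swap 6 3, e_swap 6 5,
    e_swap_left 1 0, e_swap_left 2 0, e_swap_left 2 1, e_swap_left 3 0, e_swap_left 3 1, e_swap_left 3 2, e_swap_left 5 0, e_swap_left 5 1, e_swap_left 5 2, e_swap_left 5 3, e_swap_left 6 0, e_swap_left 6 1, e_swap_left 6 2, e_swap_left 6 3, e_swap_left 6 5]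
  abel

lemma vec_mem (n : Fin 19) : vec n ∈ Submodule.span ℂ (Set.range vec) :=
  Submodule.subset_span ⟨n, rfl⟩

lemma span_eq : Submodule.span ℂ
        {x : ExteriorAlgebra ℂ (Fin 7 → ℂ) |
          ∃ p ∈ circuits, ∃ t : Fin 7,
            t ≠ p.1 ∧ t ≠ p.2.1 ∧ t ≠ p.2.2 ∧ x = e t * bdry p.1 p.2.1 p.2.2} =
    Submodule.span ℂ (Set.range vec) := by
  apply le_antisymm
  · rw [Submodule.span_le]
    rintro x ⟨p, hp, t, h1, h2, h3, rfl⟩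
    rw [SetLike.mem_coe]
    have key : (∃ n, idx n = (t, p)) ∨ (t, p) ∈
        ([(2, 1, 4, 5), (3, 1, 4, 5), (2, 1, 3, 6), (4, 1, 3, 6), (5, 1, 3, 6)] : List (Fin 7 × Fin 7 × Fin 7 × Fin 7)) := by
      revert p t
      decide +kernel
    rcases key with ⟨n, hn⟩ | h
    · have := vec_mem n
      rwa [vec, hn] at this
    · obtain ⟨i, j, k⟩ := p
      simp only [List.mem_cons, List.not_mem_nil, or_false, Prod.mk.injEq] at h
      rcases h with ⟨rfl, rfl, rfl, rfl⟩ | ⟨rfl, rfl, rfl, rfl⟩ | ⟨rfl, rfl, rfl, rfl⟩ |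
        ⟨rfl, rfl, rfl, rfl⟩ | ⟨rfl, rfl, rfl, rfl⟩
      all_goals
        simp only [rel_2145, rel_3145, rel_2136, rel_4136, rel_5136]
        repeat' with_reducible first
          | exact vec_mem _
          | apply Submodule.add_mem
          | apply Submodule.sub_mem
          | apply Submodule.neg_mem
  · rw [Submodule.span_le]
    rintro _ ⟨n, rfl⟩
    apply Submodule.subset_span
    have key : ∀ n, (idx n).2 ∈ circuits ∧ (idx n).1 ≠ (idx n).2.1 ∧
        (idx n).1 ≠ (idx n).2.2.1 ∧ (idx n).1 ≠ (idx n).2.2.2 := by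
      decide +kernel
    obtain ⟨h0, h1, h2, h3⟩ := key n
    exact ⟨(idx n).2, h0, (idx n).1, h1, h2, h3, rfl⟩

/-- The span of the 24 vectors of `F₃` for the arrangement `A(S₃)` has dimension 19. -/
theorem dim_F3_S3 :
    Module.finrank ℂ
      (Submodule.span ℂ
        {x : ExteriorAlgebra ℂ (Fin 7 → ℂ) |
          ∃ p ∈ circuits, ∃ t : Fin 7,
            t ≠ p.1 ∧ t ≠ p.2.1 ∧ t ≠ p.2.2 ∧ x = e t * bdry p.1 p.2.1 p.2.2}) = 19 := by
  rw [span_eq, finrank_span_eq_card linearIndependent_vec, Fintype.card_fin]
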